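/- Let α > 0, β > 0, and μ, x ∈ ℝ. Then sup_{z ≥ 0} [ exp( −z(x − μ)²/2 ) · ((βz)^α / α^α) · exp(α − βz) ] = ( 1 + (x − μ)²/(2β) )^{−α}. -/

import Mathlib

open Real

/-- Marginalising a normal possibility function with gamma-described precision gives the
generalised Student's t possibility function. -/
theorem stmt_12 (α β μ x : ℝ) (hα : 0 < α) (hβ : 0 < β) :
    sSup {v : ℝ | ∃ z : ℝ, 0 ≤ z ∧
        v = Real.exp (-z * (x - μ) ^ 2 / 2) * ((β * z) ^ α / α ^ α) *
          Real.exp (α - β * z)} =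
      (1 + (x - μ) ^ 2 / (2 * β)) ^ (-α) := by
  obtain ⟨c, hc⟩ : ∃ c, c = 1 + (x - μ) ^ 2 / (2 * β) := ⟨_, rfl⟩
  have hc0 : 0 < c := by rw [hc]; positivity
  have hd : (x - μ) ^ 2 = 2 * β * (c - 1) := by rw [hc]; field_simp; ring
  rw [← hc, hd]
  have key : ∀ z : ℝ, 0 ≤ z → Real.exp (-z * (2 * β * (c - 1)) / 2) *
      ((β * z) ^ α / α ^ α) * Real.exp (α - β * z) =
      c ^ (-α) * ((β * c * z / α) * Real.exp (1 - β * c * z / α)) ^ α := by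
    intro z hz
    have h1 : Real.exp (-z * (2 * β * (c - 1)) / 2) * Real.exp (α - β * z) =
        Real.exp (1 - β * c * z / α) ^ α := by
      rw [← Real.exp_add, ← Real.exp_mul]
      congr 1
      field_simp
      ring
    have h2 : (β * z) ^ α / α ^ α = c ^ (-α) * (β * c * z / α) ^ α := by
      rw [Real.rpow_neg hc0.le, ← Real.inv_rpow hc0.le,
        ← Real.mul_rpow (by positivity) (by positivity),
        ← Real.div_rpow (by positivity) hα.le]
      congr 1
      field_simp
    rw [Real.mul_rpow (x := β * c * z / α) (by positivity) (by positivity), ← h1, h2]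
    ring
  apply IsGreatest.csSup_eq
  constructor
  · refine ⟨α / (β * c), by positivity, ?_⟩
    rw [key _ (by positivity)]
    have : β * c * (α / (β * c)) / α = 1 := by field_simp
    simp [this]
  · rintro v ⟨z, hz, rfl⟩
    rw [key z hz]
    have ht : 0 ≤ β * c * z / α := by positivity
    generalize β * c * z / α = t at ht
    have h : t * Real.exp (1 - t) ≤ 1 := by
      have h3 := Real.add_one_le_exp (t - 1)
      calc t * Real.exp (1 - t) ≤ Real.exp (t - 1) * Real.exp (1 - t) := by
            gcongr; linarith
        _ = 1 := by rw [← Real.exp_add]; simp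
    have h4 := Real.rpow_le_one (by positivity) h hα.le
    exact mul_le_of_le_one_right (by positivity) h4
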